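/- (Benoist) Let n ≥ 3 be odd and let H be the subgroup of SL(n,ℝ) consisting of block matrices diag(A, 1) with A ∈ SL(n−1,ℝ). Then there is no discrete subgroup Γ of SL(n,ℝ) whose action by left multiplication on the coset space SL(n,ℝ)/H is free, properly discontinuous and cocompact; i.e., the homogeneous space SL(n−1,ℝ)\SL(n,ℝ) admits no compact Clifford–Klein form when n is odd. -/

import Mathlib

open Matrix

/-- The matrix topology on `SL(n, ℝ)`, induced from the space of matrices. -/
noncomputable instance (n : ℕ) : TopologicalSpace (Matrix.SpecialLinearGroup (Fin n) ℝ) :=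
  TopologicalSpace.induced (fun g => (g : Matrix (Fin n) (Fin n) ℝ)) inferInstance

theorem spectral_data {n : ℕ} (g : Matrix (Fin n) (Fin n) ℝ) :
    ∃ (b : Fin n → (Fin n → ℝ)) (l : Fin n → ℝ), LinearIndependent ℝ b ∧
      (∀ i j, b i ⬝ᵥ b j = if i = j then 1 else 0) ∧
      (∀ i, (gᵀ * g) *ᵥ b i = l i • b i) ∧
      (∀ v, v ⬝ᵥ v = ∑ i, (b i ⬝ᵥ v) ^ 2) ∧
      (∀ v, (g *ᵥ v) ⬝ᵥ (g *ᵥ v) = ∑ i, l i * (b i ⬝ᵥ v) ^ 2) := by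
  have hA : (gᵀ * g).IsHermitian := by
    rw [Matrix.IsHermitian, conjTranspose_eq_transpose_of_trivial]; simp
  let b0 := hA.eigenvectorBasis
  have hexp : ∀ v w : Fin n → ℝ, v ⬝ᵥ w = ∑ i, ((b0 i).ofLp ⬝ᵥ v) * ((b0 i).ofLp ⬝ᵥ w) := by
    intro v w
    have := b0.sum_inner_mul_inner (WithLp.toLp 2 v) (WithLp.toLp 2 w)
    simp only [EuclideanSpace.inner_eq_star_dotProduct, star_trivial] at this
    rw [dotProduct_comm v w, ← this]
    refine Finset.sum_congr rfl fun i _ => ?_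
    rw [dotProduct_comm w]
  have heig : ∀ i, (gᵀ * g) *ᵥ (b0 i).ofLp = hA.eigenvalues i • (b0 i).ofLp :=
    fun i => hA.mulVec_eigenvectorBasis i
  refine ⟨fun i => (b0 i).ofLp, hA.eigenvalues, ?_, ?_, heig, ?_, ?_⟩
  · have := b0.orthonormal.linearIndependent
    exact this.map' (WithLp.linearEquiv 2 ℝ (Fin n → ℝ)).toLinearMap (LinearEquiv.ker _)
  · intro i j
    have := orthonormal_iff_ite.mp b0.orthonormal j i
    simp only [EuclideanSpace.inner_eq_star_dotProduct, star_trivial] at this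
    rw [this]; simp [eq_comm]
  · intro v; rw [hexp v v]; simp [sq]
  · intro v
    have h1 : (g *ᵥ v) ⬝ᵥ (g *ᵥ v) = v ⬝ᵥ ((gᵀ * g) *ᵥ v) := by
      rw [← mulVec_mulVec, dotProduct_mulVec v, vecMul_transpose]
    rw [h1, hexp]
    refine Finset.sum_congr rfl fun i _ => ?_
    have : (b0 i).ofLp ⬝ᵥ ((gᵀ * g) *ᵥ v) = hA.eigenvalues i * ((b0 i).ofLp ⬝ᵥ v) := by
      rw [dotProduct_mulVec, ← mulVec_transpose]
      have : (gᵀ * g)ᵀ = gᵀ * g := by simp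
      rw [this, heig]; simp
    rw [this]; ring

/-- `g` expands a `k`-dimensional subspace and contracts a complementary-dimensional one. -/
def Split {n : ℕ} (C : ℝ) (g : Matrix (Fin n) (Fin n) ℝ) (k : ℕ) : Prop :=
  ∃ V W : Submodule ℝ (Fin n → ℝ), Module.finrank ℝ V = k ∧
    Module.finrank ℝ V + Module.finrank ℝ W = n ∧
    (∀ v ∈ V, v ≠ 0 → C * (v ⬝ᵥ v) < (g *ᵥ v) ⬝ᵥ (g *ᵥ v)) ∧
    (∀ v ∈ W, v ≠ 0 → C * ((g *ᵥ v) ⬝ᵥ (g *ᵥ v)) < v ⬝ᵥ v)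

theorem dot_self_nonneg' {n : ℕ} (v : Fin n → ℝ) : 0 ≤ v ⬝ᵥ v := by
  simpa using dotProduct_star_self_nonneg v

theorem dot_self_pos' {n : ℕ} {v : Fin n → ℝ} (h : v ≠ 0) : 0 < v ⬝ᵥ v :=
  lt_of_le_of_ne (dot_self_nonneg' v) fun h' => h (dotProduct_self_eq_zero.mp h'.symm)

theorem exists_split {n : ℕ} (g : Matrix (Fin n) (Fin n) ℝ) (C : ℝ) (hC : 1 ≤ C)
    (hbad : ∀ (v : Fin n → ℝ) (l : ℝ), v ⬝ᵥ v = 1 → (gᵀ * g) *ᵥ v = l • v →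
      1 ≤ C * l → l ≤ C → False) : ∃ k, Split C g k := by
  obtain ⟨b, l, hli, hb, heig, hv, hgv⟩ := spectral_data g
  have hone : ∀ i, b i ⬝ᵥ b i = 1 := fun i => by simp [hb]
  let I : Set (Fin n) := {i | C < l i}
  have hfr : ∀ s : Set (Fin n), Module.finrank ℝ (Submodule.span ℝ (b '' s)) = s.ncard := by
    intro s
    classical
    have := finrank_span_eq_card (R := ℝ) (b := fun i : s => b i)
      (hli.comp _ Subtype.val_injective)
    rw [← Set.image_eq_range] at this
    rw [this, ← Nat.card_eq_fintype_card, Nat.card_coe_set_eq]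
  have hcoord : ∀ s : Set (Fin n), ∀ v ∈ Submodule.span ℝ (b '' s), ∀ i ∉ s, b i ⬝ᵥ v = 0 := by
    intro s v hvs i hi
    induction hvs using Submodule.span_induction with
    | mem x hx =>
      obtain ⟨j, hj, rfl⟩ := hx
      rw [hb, if_neg]; rintro rfl; exact hi hj
    | zero => simp
    | add x y _ _ hx hy => simp [dotProduct_add, hx, hy]
    | smul a x _ hx => simp [hx]
  have hex : ∀ v, v ≠ 0 → ∃ i, b i ⬝ᵥ v ≠ 0 := by
    intro v hv0
    by_contra! h
    have := hv v
    simp [h] at this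
    exact hv0 this
  refine ⟨_, Submodule.span ℝ (b '' I), Submodule.span ℝ (b '' Iᶜ), rfl, ?_, ?_, ?_⟩
  · rw [hfr, hfr, Set.ncard_add_ncard_compl]; simp
  · intro v hvV hv0
    rw [hv, hgv, Finset.mul_sum]
    obtain ⟨i, hi⟩ := hex v hv0
    have hz := hcoord _ v hvV
    refine Finset.sum_lt_sum (fun j _ => ?_) ⟨i, Finset.mem_univ _, ?_⟩
    · by_cases hj : j ∈ I
      · have : C < l j := hj
        gcongr
      · simp [hz j hj]
    · have hiI : C < l i := by by_contra h; exact hi (hz i h)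
      have : 0 < (b i ⬝ᵥ v) ^ 2 := by positivity
      gcongr
  · intro v hvV hv0
    rw [hgv, hv, Finset.mul_sum]
    obtain ⟨i, hi⟩ := hex v hv0
    have hz := hcoord _ v hvV
    have hl : ∀ j, j ∈ Iᶜ → C * l j < 1 := by
      intro j hj
      by_contra h
      exact hbad (b j) (l j) (hone j) (heig j) (not_lt.mp h) (not_lt.mp hj)
    refine Finset.sum_lt_sum (fun j _ => ?_) ⟨i, Finset.mem_univ _, ?_⟩
    · by_cases hj : j ∈ Iᶜ
      · nlinarith [hl j hj, sq_nonneg (b j ⬝ᵥ v)]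
      · simp [hz j hj]
    · have hiI : i ∈ Iᶜ := by by_contra h; exact hi (hz i h)
      have : 0 < (b i ⬝ᵥ v) ^ 2 := by positivity
      nlinarith [hl i hiI]

theorem Split.mono {n : ℕ} {C : ℝ} {g : Matrix (Fin n) (Fin n) ℝ} {k : ℕ} (h : Split C g k)
    (hC : 1 ≤ C) : Split 1 g k := by
  obtain ⟨V, W, h1, h2, h3, h4⟩ := h
  refine ⟨V, W, h1, h2, fun v hv hv0 => ?_, fun v hv hv0 => ?_⟩
  · nlinarith [h3 v hv hv0, dot_self_nonneg' v]
  · nlinarith [h4 v hv hv0, dot_self_nonneg' (g *ᵥ v)]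

theorem Split.le {n : ℕ} {g : Matrix (Fin n) (Fin n) ℝ} {k k' : ℕ} (h : Split 1 g k)
    (h' : Split 1 g k') : k ≤ k' := by
  obtain ⟨V, W, h1, h2, h3, h4⟩ := h
  obtain ⟨V', W', h1', h2', h3', h4'⟩ := h'
  have hd : Disjoint V W' := by
    rw [Submodule.disjoint_def]
    intro v hv hv'
    by_contra h0
    linarith [h3 v hv h0, h4' v hv' h0]
  have := Submodule.finrank_add_finrank_le_of_disjoint hd
  simp at this
  omega

theorem Split.unique {n : ℕ} {g : Matrix (Fin n) (Fin n) ℝ} {k k' : ℕ} (h : Split 1 g k)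
    (h' : Split 1 g k') : k = k' := le_antisymm (h.le h') (h'.le h)

theorem map_finrank {n : ℕ} (s t : Matrix (Fin n) (Fin n) ℝ) (hts : t * s = 1)
    (V : Submodule ℝ (Fin n → ℝ)) :
    Module.finrank ℝ (V.map (toLin' s)) = Module.finrank ℝ V := by
  refine (LinearEquiv.finrank_eq (Submodule.equivMapOfInjective (toLin' s) ?_ V)).symm
  refine Function.LeftInverse.injective (g := toLin' t) fun v => ?_
  simp [mulVec_mulVec, hts]

theorem Split.mul {n : ℕ} {C : ℝ} {g s t : Matrix (Fin n) (Fin n) ℝ} {k : ℕ} (h : Split C g k)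
    (hst : s * t = 1) (hC : 1 ≤ C)
    (hs : ∀ v, (s *ᵥ v) ⬝ᵥ (s *ᵥ v) ≤ C * (v ⬝ᵥ v))
    (ht : ∀ v, (t *ᵥ v) ⬝ᵥ (t *ᵥ v) ≤ C * (v ⬝ᵥ v)) :
    Split 1 (g * s) k := by
  obtain ⟨V, W, h1, h2, h3, h4⟩ := h
  refine ⟨V.map (toLin' t), W.map (toLin' t), ?_, ?_, ?_, ?_⟩
  · rw [map_finrank t s hst, h1]
  · rw [map_finrank t s hst, map_finrank t s hst, h2]
  · rintro _ ⟨v, hv, rfl⟩ hv0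
    have hv1 : v ≠ 0 := by rintro rfl; simp at hv0
    simp only [toLin'_apply, mulVec_mulVec, mul_assoc, hst, mul_one]
    linarith [h3 v hv hv1, ht v]
  · rintro _ ⟨v, hv, rfl⟩ hv0
    have hv1 : v ≠ 0 := by rintro rfl; simp at hv0
    have := hs (t *ᵥ v)
    simp only [toLin'_apply, mulVec_mulVec, mul_assoc, hst, mul_one, one_mulVec] at this ⊢
    have := h4 v hv hv1
    by_contra! hcon
    nlinarith

theorem Split.inv {n : ℕ} {g t : Matrix (Fin n) (Fin n) ℝ} {k : ℕ} (h : Split 1 g k)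
    (htg : t * g = 1) : Split 1 t (n - k) := by
  obtain ⟨V, W, h1, h2, h3, h4⟩ := h
  refine ⟨W.map (toLin' g), V.map (toLin' g), ?_, ?_, ?_, ?_⟩
  · rw [map_finrank g t htg]; omega
  · rw [map_finrank g t htg, map_finrank g t htg]; omega
  · rintro _ ⟨v, hv, rfl⟩ hv0
    have hv1 : v ≠ 0 := by rintro rfl; simp at hv0
    simp only [toLin'_apply, mulVec_mulVec, htg, one_mulVec]
    exact h4 v hv hv1
  · rintro _ ⟨v, hv, rfl⟩ hv0
    have hv1 : v ≠ 0 := by rintro rfl; simp at hv0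
    simp only [toLin'_apply, mulVec_mulVec, htg, one_mulVec]
    exact h3 v hv hv1

theorem Split.k_le {n : ℕ} {C : ℝ} {g : Matrix (Fin n) (Fin n) ℝ} {k : ℕ} (h : Split C g k) :
    k ≤ n := by
  obtain ⟨V, W, h1, h2, h3, h4⟩ := h; omega

theorem exists_bound {n : ℕ} (s : Matrix (Fin n) (Fin n) ℝ) :
    ∃ C : ℝ, 0 ≤ C ∧ ∀ v, (s *ᵥ v) ⬝ᵥ (s *ᵥ v) ≤ C * (v ⬝ᵥ v) := by
  refine ⟨∑ i, ∑ j, s i j ^ 2, by positivity, fun v => ?_⟩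
  simp only [dotProduct, mulVec, Finset.sum_mul]
  refine Finset.sum_le_sum fun i _ => ?_
  have := Finset.sum_mul_sq_le_sq_mul_sq Finset.univ (s i) v
  simpa [sq, Finset.sum_mul] using this

/-- Pairs of a vector and a covector pairing to one. -/
def PX (n : ℕ) : Type :=
  {p : (Fin n → ℝ) × (Fin n → ℝ) // p.2 ⬝ᵥ p.1 = 1}

noncomputable instance (n : ℕ) : TopologicalSpace (PX n) :=
  inferInstanceAs (TopologicalSpace {p : (Fin n → ℝ) × (Fin n → ℝ) // p.2 ⬝ᵥ p.1 = 1})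

theorem PX.isClosedEmbedding (n : ℕ) :
    Topology.IsClosedEmbedding (fun x : PX n => (x.1 : (Fin n → ℝ) × (Fin n → ℝ))) :=
  (isClosed_eq (f := fun p : (Fin n → ℝ) × (Fin n → ℝ) => p.2 ⬝ᵥ p.1) (g := fun _ => 1)
    (Continuous.dotProduct continuous_snd continuous_fst)
    continuous_const).isClosedEmbedding_subtypeVal

instance (n : ℕ) : T2Space (PX n) := (PX.isClosedEmbedding n).isEmbedding.t2Space

instance (n : ℕ) : LocallyCompactSpace (PX n) := (PX.isClosedEmbedding n).locallyCompactSpace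

noncomputable instance (n : ℕ) : MulAction (Matrix.SpecialLinearGroup (Fin n) ℝ) (PX n) where
  smul g x := ⟨((g : Matrix (Fin n) (Fin n) ℝ) *ᵥ x.1.1,
    x.1.2 ᵥ* ((g⁻¹ : Matrix.SpecialLinearGroup (Fin n) ℝ) : Matrix (Fin n) (Fin n) ℝ)), by
      have h : ((g⁻¹ : Matrix.SpecialLinearGroup (Fin n) ℝ) : Matrix (Fin n) (Fin n) ℝ) *
          (g : Matrix (Fin n) (Fin n) ℝ) = 1 := by
        rw [← Matrix.SpecialLinearGroup.coe_mul, inv_mul_cancel, Matrix.SpecialLinearGroup.coe_one]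
      rw [← dotProduct_mulVec, mulVec_mulVec, h, one_mulVec]
      exact x.2⟩
  one_smul x := by
    apply Subtype.ext
    change ((_ : Fin n → ℝ), (_ : Fin n → ℝ)) = _
    rw [inv_one]; simp
  mul_smul g h x := by
    apply Subtype.ext
    change ((_ : Fin n → ℝ), (_ : Fin n → ℝ)) = ((_ : Fin n → ℝ), (_ : Fin n → ℝ))
    change _ = ((g : Matrix (Fin n) (Fin n) ℝ) *ᵥ ((h : Matrix (Fin n) (Fin n) ℝ) *ᵥ x.1.1),
      (x.1.2 ᵥ* ((h⁻¹ : Matrix.SpecialLinearGroup (Fin n) ℝ) : Matrix (Fin n) (Fin n) ℝ)) ᵥ* 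
      ((g⁻¹ : Matrix.SpecialLinearGroup (Fin n) ℝ) : Matrix (Fin n) (Fin n) ℝ))
    rw [_root_.mul_inv_rev, vecMul_vecMul, mulVec_mulVec, Matrix.SpecialLinearGroup.coe_mul,
      Matrix.SpecialLinearGroup.coe_mul]

theorem PX.smul_fst {n : ℕ} (g : Matrix.SpecialLinearGroup (Fin n) ℝ) (x : PX n) :
    (g • x).1.1 = (g : Matrix (Fin n) (Fin n) ℝ) *ᵥ x.1.1 := rfl

theorem PX.smul_snd {n : ℕ} (g : Matrix.SpecialLinearGroup (Fin n) ℝ) (x : PX n) :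
    (g • x).1.2 =
      x.1.2 ᵥ* ((g⁻¹ : Matrix.SpecialLinearGroup (Fin n) ℝ) : Matrix (Fin n) (Fin n) ℝ) := rfl

theorem SL.isClosedEmbedding (n : ℕ) :
    Topology.IsClosedEmbedding (fun g : Matrix.SpecialLinearGroup (Fin n) ℝ =>
      (g : Matrix (Fin n) (Fin n) ℝ)) := by
  refine ⟨⟨⟨rfl⟩, Subtype.val_injective⟩, ?_⟩
  have : Set.range (fun g : Matrix.SpecialLinearGroup (Fin n) ℝ =>
      (g : Matrix (Fin n) (Fin n) ℝ)) = {A | A.det = 1} := by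
    ext A; constructor
    · rintro ⟨g, rfl⟩; exact g.2
    · intro h; exact ⟨⟨A, h⟩, rfl⟩
  rw [this]
  exact isClosed_eq (Continuous.matrix_det continuous_id) continuous_const

theorem SL.continuous_coe (n : ℕ) : Continuous (fun g : Matrix.SpecialLinearGroup (Fin n) ℝ =>
      (g : Matrix (Fin n) (Fin n) ℝ)) := (SL.isClosedEmbedding n).continuous

theorem SL.continuous_coe_inv (n : ℕ) :
    Continuous (fun g : Matrix.SpecialLinearGroup (Fin n) ℝ =>
      ((g⁻¹ : Matrix.SpecialLinearGroup (Fin n) ℝ) : Matrix (Fin n) (Fin n) ℝ)) := by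
  simp only [Matrix.SpecialLinearGroup.coe_inv]
  exact Continuous.matrix_adjugate (SL.continuous_coe n)

instance SL.topGroup (n : ℕ) : IsTopologicalGroup (Matrix.SpecialLinearGroup (Fin n) ℝ) where
  continuous_mul := by
    rw [(SL.isClosedEmbedding n).isEmbedding.continuous_iff]
    exact Continuous.matrix_mul ((SL.continuous_coe n).comp continuous_fst)
      ((SL.continuous_coe n).comp continuous_snd)
  continuous_inv := by
    rw [(SL.isClosedEmbedding n).isEmbedding.continuous_iff]
    exact SL.continuous_coe_inv n

instance SL.sigmaCompact (n : ℕ) : SigmaCompactSpace (Matrix.SpecialLinearGroup (Fin n) ℝ) := by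
  have : SigmaCompactSpace (Matrix (Fin n) (Fin n) ℝ) :=
    inferInstanceAs (SigmaCompactSpace (Fin n → Fin n → ℝ))
  exact (SL.isClosedEmbedding n).sigmaCompactSpace

instance PX.contSMul (n : ℕ) : ContinuousSMul (Matrix.SpecialLinearGroup (Fin n) ℝ) (PX n) where
  continuous_smul := by
    rw [(PX.isClosedEmbedding n).isEmbedding.continuous_iff]
    refine Continuous.prodMk ?_ ?_
    · exact Continuous.matrix_mulVec ((SL.continuous_coe n).comp continuous_fst)
        (continuous_fst.comp ((PX.isClosedEmbedding n).continuous.comp continuous_snd))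
    · exact Continuous.matrix_vecMul
        (continuous_snd.comp ((PX.isClosedEmbedding n).continuous.comp continuous_snd))
        ((SL.continuous_coe_inv n).comp continuous_fst)

/-- sublevel set -/
def PX.ball (n : ℕ) (R : ℝ) : Set (PX n) := {x | x.1.1 ⬝ᵥ x.1.1 ≤ R ∧ x.1.2 ⬝ᵥ x.1.2 ≤ R}

theorem abs_le_of_dot {n : ℕ} {v : Fin n → ℝ} {R : ℝ} (h : v ⬝ᵥ v ≤ R) (i : Fin n) :
    |v i| ≤ R + 1 := by
  have : v i * v i ≤ v ⬝ᵥ v :=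
    Finset.single_le_sum (f := fun i => v i * v i) (fun i _ => mul_self_nonneg _)
      (Finset.mem_univ i)
  rw [abs_le]; constructor <;> nlinarith [mul_self_nonneg (v i + 1), mul_self_nonneg (v i - 1)]

theorem PX.continuous_fst (n : ℕ) : Continuous (fun x : PX n => x.1.1) :=
  _root_.continuous_fst.comp (PX.isClosedEmbedding n).continuous

theorem PX.continuous_snd (n : ℕ) : Continuous (fun x : PX n => x.1.2) :=
  _root_.continuous_snd.comp (PX.isClosedEmbedding n).continuous

theorem PX.isCompact_ball (n : ℕ) (R : ℝ) : IsCompact (PX.ball n R) := by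
  have hc : IsCompact ((Set.univ.pi fun _ : Fin n => Set.Icc (-(R+1)) (R+1)) ×ˢ
      (Set.univ.pi fun _ : Fin n => Set.Icc (-(R+1)) (R+1))) :=
    (isCompact_univ_pi fun _ => isCompact_Icc).prod (isCompact_univ_pi fun _ => isCompact_Icc)
  refine IsCompact.of_isClosed_subset ((PX.isClosedEmbedding n).isCompact_preimage hc) ?_ ?_
  · have h1 : IsClosed {x : PX n | x.1.1 ⬝ᵥ x.1.1 ≤ R} := isClosed_le
      ((PX.continuous_fst n).dotProduct (PX.continuous_fst n)) continuous_const
    have h2 : IsClosed {x : PX n | x.1.2 ⬝ᵥ x.1.2 ≤ R} := isClosed_le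
      ((PX.continuous_snd n).dotProduct (PX.continuous_snd n)) continuous_const
    exact h1.inter h2
  · rintro x ⟨h1, h2⟩
    simp only [Set.mem_preimage, Set.mem_prod, Set.mem_univ_pi, Set.mem_Icc]
    exact ⟨fun i => abs_le.mp (abs_le_of_dot h1 i), fun i => abs_le.mp (abs_le_of_dot h2 i)⟩

theorem PX.exists_ball {n : ℕ} {K : Set (PX n)} (hK : IsCompact K) : ∃ R, 0 ≤ R ∧ K ⊆ PX.ball n R := by
  obtain ⟨a, ha⟩ := (hK.image ((PX.continuous_fst n).dotProduct (PX.continuous_fst n))).bddAbove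
  obtain ⟨b, hb⟩ := (hK.image ((PX.continuous_snd n).dotProduct (PX.continuous_snd n))).bddAbove
  refine ⟨max 0 (max a b), le_max_left _ _, fun x hx => ⟨?_, ?_⟩⟩
  · exact (ha ⟨x, hx, rfl⟩).trans (by simp)
  · exact (hb ⟨x, hx, rfl⟩).trans (by simp)

theorem isConnected_far (n : ℕ) (hn : 2 ≤ n) (R : ℝ) (hR : 0 ≤ R) :
    IsPreconnected {v : Fin n → ℝ | R < v ⬝ᵥ v} := by
  have hrank : 1 < Module.rank ℝ (EuclideanSpace ℝ (Fin n)) := by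
    rw [← Module.finrank_eq_rank]; simp; omega
  have hs := isPreconnected_sphere hrank (0 : EuclideanSpace ℝ (Fin n)) 1
  have hI : IsPreconnected (Set.Ioi (Real.sqrt R)) := isPreconnected_Ioi
  have := (hI.prod hs).image (fun p => p.1 • p.2.ofLp) (by fun_prop)
  convert this using 1
  have hd : ∀ v : EuclideanSpace ℝ (Fin n), v.ofLp ⬝ᵥ v.ofLp = ‖v‖ ^ 2 := by
    intro v
    rw [EuclideanSpace.real_norm_sq_eq]; simp [dotProduct, sq]
  ext v
  simp only [Set.mem_ofPred_eq, Set.mem_image, Set.mem_prod, Set.mem_Ioi, mem_sphere_zero_iff_norm,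
    Prod.exists]
  constructor
  · intro hv
    have h1 := hd (WithLp.toLp 2 v)
    simp only at h1
    rw [h1] at hv
    have hpos : Real.sqrt R < ‖WithLp.toLp 2 v‖ := by
      rw [Real.sqrt_lt' ]
      · exact hv
      · by_contra h
        have : ‖WithLp.toLp 2 v‖ = 0 := le_antisymm (not_lt.mp h) (norm_nonneg _)
        rw [this] at hv; norm_num at hv; linarith
    have h0 : 0 < ‖WithLp.toLp 2 v‖ := (Real.sqrt_nonneg _).trans_lt hpos
    refine ⟨‖WithLp.toLp 2 v‖, ‖WithLp.toLp 2 v‖⁻¹ • WithLp.toLp 2 v, ⟨hpos, ?_⟩, ?_⟩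
    · rw [norm_smul, norm_inv, norm_norm, inv_mul_cancel₀ h0.ne']
    · simp [smul_smul, mul_inv_cancel₀ h0.ne']
  · rintro ⟨r, w, ⟨hr, hw⟩, rfl⟩
    rw [smul_dotProduct, dotProduct_smul, hd, hw]
    have := (Real.sqrt_lt' ((Real.sqrt_nonneg _).trans_lt hr)).mp hr
    simp; nlinarith

theorem PX.far1 (n : ℕ) (hn : 2 ≤ n) (R : ℝ) (hR : 0 ≤ R) :
    IsPreconnected {x : PX n | R < x.1.1 ⬝ᵥ x.1.1} := by
  rw [← (PX.isClosedEmbedding n).isInducing.isPreconnected_image]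
  have := ((isConnected_far n hn R hR).prod (isPreconnected_univ (α := Fin n → ℝ))).image
    (fun p => (p.1, (p.1 ⬝ᵥ p.1)⁻¹ • p.1 + p.2 - ((p.2 ⬝ᵥ p.1) * (p.1 ⬝ᵥ p.1)⁻¹) • p.1)) (by
      have : ContinuousOn (fun p : (Fin n → ℝ) × (Fin n → ℝ) => (p.1 ⬝ᵥ p.1)⁻¹)
          ({v : Fin n → ℝ | R < v ⬝ᵥ v} ×ˢ Set.univ) := by
        refine ContinuousOn.inv₀ (Continuous.continuousOn
          (Continuous.dotProduct _root_.continuous_fst _root_.continuous_fst)) ?_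
        rintro ⟨v, w⟩ ⟨h, -⟩
        have : R < v ⬝ᵥ v := h
        exact (hR.trans_lt this).ne'
      have h2 : Continuous (fun p : (Fin n → ℝ) × (Fin n → ℝ) => (p.2 ⬝ᵥ p.1)) :=
        Continuous.dotProduct _root_.continuous_snd _root_.continuous_fst
      refine continuousOn_fst.prodMk ?_
      exact ((this.smul continuousOn_fst).add continuousOn_snd).sub
        ((h2.continuousOn.mul this).smul continuousOn_fst))
  convert this using 1
  ext ⟨v, f⟩
  simp only [Set.mem_image, Set.mem_prod, Set.mem_ofPred_eq, Set.mem_univ, and_true, Prod.exists,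
    Prod.mk.injEq]
  constructor
  · rintro ⟨x, hx, hxe⟩
    have hx1 : x.1.1 = v := by rw [hxe]
    have hx2 : x.1.2 = f := by rw [hxe]
    refine ⟨v, f, hx1 ▸ hx, rfl, ?_⟩
    have : f ⬝ᵥ v = 1 := by rw [← hx1, ← hx2]; exact x.2
    rw [this]; simp
  · rintro ⟨v', w, h, rfl, rfl⟩
    have h0 : v' ⬝ᵥ v' ≠ 0 := (hR.trans_lt h).ne'
    refine ⟨⟨(v', _), ?_⟩, h, rfl⟩
    simp [sub_dotProduct, add_dotProduct, h0]

/-- swap vector and covector -/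
def PX.swap {n : ℕ} (x : PX n) : PX n := ⟨(x.1.2, x.1.1), by rw [dotProduct_comm]; exact x.2⟩

theorem PX.continuous_swap (n : ℕ) : Continuous (PX.swap (n := n)) := by
  rw [(PX.isClosedEmbedding n).isEmbedding.continuous_iff]
  exact (PX.continuous_snd n).prodMk (PX.continuous_fst n)

theorem PX.far2 (n : ℕ) (hn : 2 ≤ n) (R : ℝ) (hR : 0 ≤ R) :
    IsPreconnected {x : PX n | R < x.1.2 ⬝ᵥ x.1.2} := by
  have := (PX.far1 n hn R hR).image _ (PX.continuous_swap n).continuousOn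
  convert this using 1
  ext x; constructor
  · intro h; exact ⟨x.swap, h, rfl⟩
  · rintro ⟨y, h, rfl⟩; exact h

theorem PX.exists_far (n : ℕ) (hn : 2 ≤ n) (R : ℝ) (hR : 0 ≤ R) :
    ∃ x : PX n, R < x.1.1 ⬝ᵥ x.1.1 ∧ R < x.1.2 ⬝ᵥ x.1.2 := by
  let i : Fin n := ⟨0, by omega⟩
  let j : Fin n := ⟨1, by omega⟩
  have hij : i ≠ j := by simp [i, j]
  let v : Fin n → ℝ := Pi.single i 1 + Pi.single j (R + 1)
  let f : Fin n → ℝ := Pi.single i (1 + (R + 1) ^ 2 : ℝ) - Pi.single j (R + 1)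
  refine ⟨⟨(v, f), ?_⟩, ?_, ?_⟩
  · change f ⬝ᵥ v = 1
    simp [f, v, hij, hij.symm, sub_dotProduct]; ring
  · change R < v ⬝ᵥ v
    simp [v, hij, hij.symm, add_dotProduct]; nlinarith
  · change R < f ⬝ᵥ f
    simp [f, hij, hij.symm, sub_dotProduct]; nlinarith [sq_nonneg (1 + (R + 1) ^ 2)]

theorem PX.preconnected_compl_ball (n : ℕ) (hn : 2 ≤ n) (R : ℝ) (hR : 0 ≤ R) :
    IsPreconnected (PX.ball n R)ᶜ := by
  obtain ⟨x, h1, h2⟩ := PX.exists_far n hn R hR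
  convert IsPreconnected.union x h1 h2 (PX.far1 n hn R hR) (PX.far2 n hn R hR) using 1
  ext y
  simp only [PX.ball, Set.mem_compl_iff, Set.mem_ofPred_eq, Set.mem_union, not_and_or, not_le]

theorem PX.compl_ball_nonempty (n : ℕ) (hn : 2 ≤ n) (R : ℝ) (hR : 0 ≤ R) :
    ((PX.ball n R)ᶜ).Nonempty := by
  obtain ⟨x, h1, h2⟩ := PX.exists_far n hn R hR
  exact ⟨x, fun h => absurd h.1 (not_le.mpr h1)⟩

theorem SL.inv_mul_coe {n : ℕ} (g : Matrix.SpecialLinearGroup (Fin n) ℝ) :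
    ((g⁻¹ : Matrix.SpecialLinearGroup (Fin n) ℝ) : Matrix (Fin n) (Fin n) ℝ) *
      (g : Matrix (Fin n) (Fin n) ℝ) = 1 := by
  rw [← Matrix.SpecialLinearGroup.coe_mul, inv_mul_cancel, Matrix.SpecialLinearGroup.coe_one]

theorem SL.mul_inv_coe {n : ℕ} (g : Matrix.SpecialLinearGroup (Fin n) ℝ) :
    (g : Matrix (Fin n) (Fin n) ℝ) *
    ((g⁻¹ : Matrix.SpecialLinearGroup (Fin n) ℝ) : Matrix (Fin n) (Fin n) ℝ) = 1 := by
  rw [← Matrix.SpecialLinearGroup.coe_mul, mul_inv_cancel, Matrix.SpecialLinearGroup.coe_one]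

theorem split_or_meets {n : ℕ} (g : Matrix.SpecialLinearGroup (Fin n) ℝ) (C : ℝ) (hC : 1 ≤ C)
    (h : ¬ ∃ x ∈ PX.ball n C, g • x ∈ PX.ball n C) :
    ∃ k, Split C (g : Matrix (Fin n) (Fin n) ℝ) k := by
  refine exists_split _ C hC fun v l hv hl h1 h2 => h ?_
  have hl0 : 0 < l := by by_contra h0; nlinarith
  have hgg : ((g : Matrix (Fin n) (Fin n) ℝ) *ᵥ v) ⬝ᵥ ((g : Matrix (Fin n) (Fin n) ℝ) *ᵥ v) = l := by
    have : ((g : Matrix (Fin n) (Fin n) ℝ) *ᵥ v) ⬝ᵥ ((g : Matrix (Fin n) (Fin n) ℝ) *ᵥ v) =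
        v ⬝ᵥ (((g : Matrix (Fin n) (Fin n) ℝ)ᵀ * (g : Matrix (Fin n) (Fin n) ℝ)) *ᵥ v) := by
      rw [← mulVec_mulVec, dotProduct_mulVec v, vecMul_transpose]
    rw [this, hl, dotProduct_smul, hv]; simp
  have hinv : v ᵥ* ((g⁻¹ : Matrix.SpecialLinearGroup (Fin n) ℝ) : Matrix (Fin n) (Fin n) ℝ) =
      l⁻¹ • ((g : Matrix (Fin n) (Fin n) ℝ) *ᵥ v) := by
    have e : v = l⁻¹ • (((g : Matrix (Fin n) (Fin n) ℝ) *ᵥ v) ᵥ* (g : Matrix (Fin n) (Fin n) ℝ)) := by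
      rw [← mulVec_transpose, mulVec_mulVec, hl, smul_smul, inv_mul_cancel₀ hl0.ne', one_smul]
    conv_lhs => rw [e]
    rw [smul_vecMul, vecMul_vecMul, SL.mul_inv_coe, vecMul_one]
  refine ⟨⟨(v, v), hv⟩, ⟨hv.le.trans hC, hv.le.trans hC⟩, ?_, ?_⟩
  · exact hgg.le.trans h2
  · change (v ᵥ* ((g⁻¹ : Matrix.SpecialLinearGroup (Fin n) ℝ) : Matrix (Fin n) (Fin n) ℝ)) ⬝ᵥ 
      (v ᵥ* ((g⁻¹ : Matrix.SpecialLinearGroup (Fin n) ℝ) : Matrix (Fin n) (Fin n) ℝ)) ≤ C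
    rw [hinv, smul_dotProduct, dotProduct_smul, hgg]
    simp only [smul_eq_mul]
    rw [inv_mul_cancel₀ hl0.ne', mul_one, inv_le_iff_one_le_mul₀ hl0]
    exact h1

theorem PX.main (n : ℕ) (hn : 2 ≤ n) (hodd : Odd n)
    (Γ : Subgroup (Matrix.SpecialLinearGroup (Fin n) ℝ))
    (hprop : ∀ K L : Set (PX n), IsCompact K → IsCompact L →
      {γ : Γ | ∃ x ∈ K, ((γ : Matrix.SpecialLinearGroup (Fin n) ℝ) • x) ∈ L}.Finite)
    (hcc : ∃ K : Set (PX n), IsCompact K ∧ ∀ x : PX n, ∃ γ ∈ Γ, ∃ y ∈ K, γ • y = x) : False := by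
  obtain ⟨D0, hD0, hcov⟩ := hcc
  obtain ⟨D, hD, hD0D⟩ := exists_compact_superset hD0
  set U := interior D with hU
  -- uniform bound for the finite set of returns
  have hS := hprop D D hD hD
  obtain ⟨C, hC1, hC⟩ : ∃ C : ℝ, 1 ≤ C ∧
      ∀ s ∈ {γ : Γ | ∃ x ∈ D, ((γ : Matrix.SpecialLinearGroup (Fin n) ℝ) • x) ∈ D},
      (∀ v, (((s : Matrix.SpecialLinearGroup (Fin n) ℝ) : Matrix (Fin n) (Fin n) ℝ) *ᵥ v) ⬝ᵥ
        (((s : Matrix.SpecialLinearGroup (Fin n) ℝ) : Matrix (Fin n) (Fin n) ℝ) *ᵥ v)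
          ≤ C * (v ⬝ᵥ v)) ∧
      (∀ v, ((((s : Matrix.SpecialLinearGroup (Fin n) ℝ)⁻¹ : Matrix.SpecialLinearGroup (Fin n) ℝ) :
          Matrix (Fin n) (Fin n) ℝ) *ᵥ v) ⬝ᵥ
        ((((s : Matrix.SpecialLinearGroup (Fin n) ℝ)⁻¹ : Matrix.SpecialLinearGroup (Fin n) ℝ) :
          Matrix (Fin n) (Fin n) ℝ) *ᵥ v) ≤ C * (v ⬝ᵥ v)) := by
    choose B hB0 hB using fun s : Matrix (Fin n) (Fin n) ℝ => exists_bound s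
    obtain ⟨a, ha⟩ := (hS.image fun s : Γ =>
      B ((s : Matrix.SpecialLinearGroup (Fin n) ℝ) : Matrix (Fin n) (Fin n) ℝ)).bddAbove
    obtain ⟨b, hb⟩ := (hS.image fun s : Γ =>
      B (((s : Matrix.SpecialLinearGroup (Fin n) ℝ)⁻¹ : Matrix.SpecialLinearGroup (Fin n) ℝ) :
        Matrix (Fin n) (Fin n) ℝ)).bddAbove
    refine ⟨max 1 (max a b), le_max_left _ _, fun s hs => ⟨fun v => ?_, fun v => ?_⟩⟩
    · refine (hB _ v).trans (mul_le_mul_of_nonneg_right ?_ (dot_self_nonneg' v))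
      exact (ha ⟨s, hs, rfl⟩).trans (by simp)
    · refine (hB _ v).trans (mul_le_mul_of_nonneg_right ?_ (dot_self_nonneg' v))
      exact (hb ⟨s, hs, rfl⟩).trans (by simp)
  -- the finite bad set
  set F : Set Γ := {γ : Γ | ∃ x ∈ PX.ball n C,
    ((γ : Matrix.SpecialLinearGroup (Fin n) ℝ) • x) ∈ PX.ball n C} with hF
  have hFfin : F.Finite := hprop _ _ (PX.isCompact_ball n C) (PX.isCompact_ball n C)
  have hgood : ∀ γ : Γ, γ ∉ F → ∃ k,
      Split C ((γ : Matrix.SpecialLinearGroup (Fin n) ℝ) : Matrix (Fin n) (Fin n) ℝ) k :=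
    fun γ h => split_or_meets _ C hC1 h
  have hsmul : ∀ γ : Γ, Continuous
      (fun x : PX n => (γ : Matrix.SpecialLinearGroup (Fin n) ℝ) • x) :=
    fun γ => continuous_const_smul _
  have hK : IsCompact (⋃ γ ∈ F,
      (fun x : PX n => (γ : Matrix.SpecialLinearGroup (Fin n) ℝ) • x) '' D) :=
    hFfin.isCompact_biUnion fun γ _ => hD.image (hsmul γ)
  obtain ⟨R, hR, hKR⟩ := PX.exists_ball hK
  -- the locally constant function
  let A : ℕ → Set (PX n) := fun j => ⋃ γ ∈ {γ : Γ | γ ∉ F ∧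
      Split 1 ((γ : Matrix.SpecialLinearGroup (Fin n) ℝ) : Matrix (Fin n) (Fin n) ℝ) j},
      (fun x : PX n => (γ : Matrix.SpecialLinearGroup (Fin n) ℝ) • x) '' U
  have hAopen : ∀ j, IsOpen (A j) := fun j => isOpen_biUnion fun γ _ =>
    (isOpenMap_smul (γ : Matrix.SpecialLinearGroup (Fin n) ℝ)) _ isOpen_interior
  have hAdisj : ∀ i j x, x ∈ A i → x ∈ A j → i = j := by
    intro i j x hi hj
    simp only [A, Set.mem_iUnion, Set.mem_image, exists_prop] at hi hj
    obtain ⟨γ, ⟨hγ, hγi⟩, u, hu, rfl⟩ := hi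
    obtain ⟨δ, ⟨hδ, hδj⟩, w, hw, hwe⟩ := hj
    obtain ⟨k, hk⟩ := hgood γ hγ
    have hs : (γ⁻¹ * δ) ∈ {γ : Γ | ∃ x ∈ D, ((γ : Matrix.SpecialLinearGroup (Fin n) ℝ) • x) ∈ D} := by
      refine ⟨w, interior_subset hw, ?_⟩
      rw [Subgroup.coe_mul, mul_smul, hwe, Subgroup.coe_inv, inv_smul_smul]
      exact interior_subset hu
    obtain ⟨hs1, hs2⟩ := hC _ hs
    have h1 := hk.mul (SL.mul_inv_coe _) hC1 hs1 hs2
    rw [← Matrix.SpecialLinearGroup.coe_mul, ← Subgroup.coe_mul, mul_inv_cancel_left] at h1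
    rw [hγi.unique (hk.mono hC1), hδj.unique h1]
  have hYA : ∀ x ∈ (PX.ball n R)ᶜ, ∃ j, x ∈ A j := by
    intro x hx
    obtain ⟨γ, hγ, y, hy, rfl⟩ := hcov x
    have hγF : (⟨γ, hγ⟩ : Γ) ∉ F := fun h => hx (hKR (Set.mem_biUnion h
      ⟨y, interior_subset (hD0D hy), rfl⟩))
    obtain ⟨k, hk⟩ := hgood _ hγF
    exact ⟨k, Set.mem_biUnion (show (⟨γ, hγ⟩ : Γ) ∈ _ from ⟨hγF, hk.mono hC1⟩) ⟨y, hD0D hy, rfl⟩⟩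
  obtain ⟨y0, hy0⟩ := PX.compl_ball_nonempty n hn R hR
  obtain ⟨j, hj⟩ := hYA y0 hy0
  have hYj : (PX.ball n R)ᶜ ⊆ A j := by
    refine IsPreconnected.subset_left_of_subset_union (v := ⋃ i ∈ {i | i ≠ j}, A i) (hAopen j)
      (isOpen_biUnion fun i _ => hAopen i) ?_ ?_ ⟨y0, hy0, hj⟩
      (PX.preconnected_compl_ball n hn R hR)
    · rw [Set.disjoint_left]
      intro x hx hx'
      simp only [Set.mem_iUnion, exists_prop] at hx'
      obtain ⟨i, hi, hxi⟩ := hx'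
      exact hi (hAdisj _ _ _ hxi hx)
    · intro x hx
      obtain ⟨i, hi⟩ := hYA x hx
      by_cases hij : i = j
      · left; exact hij ▸ hi
      · right; exact Set.mem_biUnion (show i ∈ {i | i ≠ j} from hij) hi
  -- Γ is infinite
  have hinf : Infinite Γ := by
    by_contra hfin
    rw [not_infinite_iff_finite] at hfin
    have hc : IsCompact (⋃ γ : Γ,
        (fun x : PX n => (γ : Matrix.SpecialLinearGroup (Fin n) ℝ) • x) '' D0) :=
      isCompact_iUnion fun γ => hD0.image (hsmul γ)
    obtain ⟨R', hR', hKR'⟩ := PX.exists_ball hc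
    obtain ⟨y, hy⟩ := PX.compl_ball_nonempty n hn R' hR'
    obtain ⟨γ, hγ, z, hz, rfl⟩ := hcov y
    exact hy (hKR' (Set.mem_iUnion.mpr ⟨⟨γ, hγ⟩, z, hz, rfl⟩))
  obtain ⟨γ0, -, u, hu0, -⟩ := hcov y0
  have hu : u ∈ U := hD0D hu0
  have hE := hprop D (PX.ball n R) hD (PX.isCompact_ball n R)
  set E := {γ : Γ | ∃ x ∈ D, ((γ : Matrix.SpecialLinearGroup (Fin n) ℝ) • x) ∈ PX.ball n R}
  have hkey : ∀ γ : Γ, γ ∉ F ∪ E →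
      Split 1 ((γ : Matrix.SpecialLinearGroup (Fin n) ℝ) : Matrix (Fin n) (Fin n) ℝ) j := by
    intro γ hγ
    rw [Set.mem_union, not_or] at hγ
    obtain ⟨k, hk⟩ := hgood γ hγ.1
    have h1 := hYj (show (γ : Matrix.SpecialLinearGroup (Fin n) ℝ) • u ∈ (PX.ball n R)ᶜ from
      fun h => hγ.2 ⟨u, interior_subset hu, h⟩)
    have h2 : (γ : Matrix.SpecialLinearGroup (Fin n) ℝ) • u ∈ A k :=
      Set.mem_biUnion (show γ ∈ _ from ⟨hγ.1, hk.mono hC1⟩) ⟨u, hu, rfl⟩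
    rw [hAdisj _ _ _ h1 h2]
    exact hk.mono hC1
  have hfin : ((F ∪ E) ∪ (fun γ : Γ => γ⁻¹) ⁻¹' (F ∪ E)).Finite :=
    (hFfin.union hE).union ((hFfin.union hE).preimage inv_injective.injOn)
  obtain ⟨γ, hγ⟩ := hfin.exists_notMem
  rw [Set.mem_union, not_or] at hγ
  have h1 := hkey γ hγ.1
  have h2 := hkey γ⁻¹ hγ.2
  rw [Subgroup.coe_inv] at h2
  have h3 := h1.inv (SL.inv_mul_coe _)
  have h4 := h2.unique h3
  have h5 := h1.k_le
  obtain ⟨m, hm⟩ := hodd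
  omega

theorem PX.transitive_aux (m : ℕ) (hm : 1 ≤ m) (v f : Fin (m + 1) → ℝ) (hfv : f ⬝ᵥ v = 1) :
    ∃ g : Matrix.SpecialLinearGroup (Fin (m + 1)) ℝ,
      (g : Matrix (Fin (m + 1)) (Fin (m + 1)) ℝ) *ᵥ (Pi.single (Fin.last m) 1) = v ∧
      f ᵥ* (g : Matrix (Fin (m + 1)) (Fin (m + 1)) ℝ) = Pi.single (Fin.last m) 1 := by
  let φ : (Fin (m + 1) → ℝ) →ₗ[ℝ] ℝ := dotProductBilin ℝ ℝ f
  have hφ : ∀ w, φ w = f ⬝ᵥ w := fun w => rfl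
  have hsurj : LinearMap.range φ = ⊤ := by
    rw [LinearMap.range_eq_top]
    intro c
    exact ⟨c • v, by rw [map_smul, hφ, hfv]; simp⟩
  have hker : Module.finrank ℝ (LinearMap.ker φ) = m := by
    have := LinearMap.finrank_range_add_finrank_ker φ
    rw [hsurj] at this
    simp at this
    omega
  let b := Module.finBasisOfFinrankEq ℝ (LinearMap.ker φ) hker
  let c : Fin m → (Fin (m + 1) → ℝ) := fun i => (b i : Fin (m + 1) → ℝ)
  have hc : ∀ i, f ⬝ᵥ c i = 0 := fun i => (b i).2
  let col : Fin (m + 1) → (Fin (m + 1) → ℝ) := Fin.snoc c v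
  have hli : LinearIndependent ℝ col := by
    rw [linearIndependent_finSnoc]
    refine ⟨b.linearIndependent.map' (LinearMap.ker φ).subtype (Submodule.ker_subtype _), ?_⟩
    intro h
    have hle : Submodule.span ℝ (Set.range c) ≤ LinearMap.ker φ := by
      rw [Submodule.span_le]; rintro _ ⟨i, rfl⟩; exact (b i).2
    have h0 : f ⬝ᵥ v = 0 := hle h
    rw [hfv] at h0; exact one_ne_zero h0
  let M : Matrix (Fin (m + 1)) (Fin (m + 1)) ℝ := Matrix.of fun i j => col j i
  have hunit : IsUnit M := by
    rw [← Matrix.linearIndependent_cols_iff_isUnit]; exact hli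
  have hdet : M.det ≠ 0 := (M.isUnit_iff_isUnit_det.mp hunit).ne_zero
  let d : Fin (m + 1) → ℝ := Function.update 1 0 (M.det)⁻¹
  have hl0 : Fin.last m ≠ 0 := by
    intro h; have := congrArg Fin.val h; simp at this; omega
  have hd : d (Fin.last m) = 1 := by simp [d, hl0]
  refine ⟨⟨M * diagonal d, ?_⟩, ?_, ?_⟩
  · rw [det_mul, det_diagonal, Finset.prod_update_of_mem (Finset.mem_univ _)]
    simp [hdet]
  · change (M * diagonal d) *ᵥ _ = _
    ext i
    simp [mul_diagonal, hd, M, col]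
  · change f ᵥ* (M * diagonal d) = _
    ext j
    have h1 : (f ᵥ* M) j = f ⬝ᵥ col j := rfl
    rw [← vecMul_vecMul, vecMul_diagonal, h1]
    refine Fin.lastCases ?_ (fun i => ?_) j
    · simp [col, hfv, hd]
    · simp [col, hc]

/-- base point -/
noncomputable def PX.base (m : ℕ) : PX (m + 1) :=
  ⟨(Pi.single (Fin.last m) 1, Pi.single (Fin.last m) 1), by simp⟩

theorem PX.smul_base_eq {m : ℕ} (g : Matrix.SpecialLinearGroup (Fin (m + 1)) ℝ) (x : PX (m + 1)) :
    g • PX.base m = x ↔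
      (g : Matrix (Fin (m + 1)) (Fin (m + 1)) ℝ) *ᵥ (Pi.single (Fin.last m) 1) = x.1.1 ∧
      x.1.2 ᵥ* (g : Matrix (Fin (m + 1)) (Fin (m + 1)) ℝ) = Pi.single (Fin.last m) 1 := by
  constructor
  · rintro rfl
    refine ⟨rfl, ?_⟩
    rw [PX.smul_snd, vecMul_vecMul, SL.inv_mul_coe, vecMul_one]; rfl
  · rintro ⟨h1, h2⟩
    apply Subtype.ext
    apply Prod.ext
    · rw [PX.smul_fst]; exact h1
    · rw [PX.smul_snd]
      change Pi.single (Fin.last m) 1 ᵥ* _ = _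
      rw [← h2, vecMul_vecMul, SL.mul_inv_coe, vecMul_one]

theorem PX.pretransitive (m : ℕ) (hm : 1 ≤ m) :
    MulAction.IsPretransitive (Matrix.SpecialLinearGroup (Fin (m + 1)) ℝ) (PX (m + 1)) := by
  have h : ∀ x : PX (m + 1), ∃ g : Matrix.SpecialLinearGroup (Fin (m + 1)) ℝ,
      g • PX.base m = x := by
    intro x
    obtain ⟨g, h1, h2⟩ := PX.transitive_aux m hm x.1.1 x.1.2 x.2
    exact ⟨g, (PX.smul_base_eq g x).mpr ⟨h1, h2⟩⟩
  refine ⟨fun x y => ?_⟩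
  obtain ⟨g, rfl⟩ := h x
  obtain ⟨k, rfl⟩ := h y
  exact ⟨k * g⁻¹, by rw [mul_smul, inv_smul_smul]⟩

theorem H_eq_stabilizer (m : ℕ) (H : Subgroup (Matrix.SpecialLinearGroup (Fin (m + 1)) ℝ))
    (hH : (H : Set (Matrix.SpecialLinearGroup (Fin (m + 1)) ℝ)) =
      {g : Matrix.SpecialLinearGroup (Fin (m + 1)) ℝ | ∀ i j : Fin (m + 1),
        (m + 1 - 1 ≤ (i : ℕ) ∨ m + 1 - 1 ≤ (j : ℕ)) →
        (g : Matrix (Fin (m + 1)) (Fin (m + 1)) ℝ) i j = if i = j then 1 else 0}) :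
    H = MulAction.stabilizer (Matrix.SpecialLinearGroup (Fin (m + 1)) ℝ) (PX.base m) := by
  ext g
  have hlast : ∀ i : Fin (m + 1), m + 1 - 1 ≤ (i : ℕ) ↔ i = Fin.last m := by
    intro i; rw [Fin.ext_iff, Fin.val_last]; omega
  have hg : g ∈ H ↔ ∀ i j : Fin (m + 1),
        (m + 1 - 1 ≤ (i : ℕ) ∨ m + 1 - 1 ≤ (j : ℕ)) →
        (g : Matrix (Fin (m + 1)) (Fin (m + 1)) ℝ) i j = if i = j then 1 else 0 := by
    rw [← SetLike.mem_coe, hH]; rfl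
  rw [hg, MulAction.mem_stabilizer_iff, PX.smul_base_eq]
  change _ ↔ _ = Pi.single (Fin.last m) 1 ∧ Pi.single (Fin.last m) 1 ᵥ* _ = _
  rw [mulVec_single_one, single_one_vecMul]
  constructor
  · intro h
    constructor
    · ext i
      have := h i (Fin.last m) (Or.inr ((hlast _).mpr rfl))
      simpa [Pi.single_apply] using this
    · ext j
      have := h (Fin.last m) j (Or.inl ((hlast _).mpr rfl))
      simpa [Pi.single_apply, eq_comm] using this
  · rintro ⟨h1, h2⟩ i j hij
    rw [hlast, hlast] at hij
    rcases hij with rfl | rfl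
    · have := congrFun h2 j
      simpa [Pi.single_apply, eq_comm] using this
    · have := congrFun h1 i
      simpa [Pi.single_apply, eq_comm] using this

theorem benoist_no_compact_form (n : ℕ) (hn : 3 ≤ n) (hodd : Odd n)
    (H : Subgroup (Matrix.SpecialLinearGroup (Fin n) ℝ))
    (hH : (H : Set (Matrix.SpecialLinearGroup (Fin n) ℝ)) =
      {g : Matrix.SpecialLinearGroup (Fin n) ℝ | ∀ i j : Fin n,
        (n - 1 ≤ (i : ℕ) ∨ n - 1 ≤ (j : ℕ)) →
        (g : Matrix (Fin n) (Fin n) ℝ) i j = if i = j then 1 else 0})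
    (Γ : Subgroup (Matrix.SpecialLinearGroup (Fin n) ℝ))
    (hdisc : DiscreteTopology Γ) :
    ¬ ((∀ γ : Γ, (∃ x : Matrix.SpecialLinearGroup (Fin n) ℝ ⧸ H,
          (γ : Matrix.SpecialLinearGroup (Fin n) ℝ) • x = x) → γ = 1) ∧
        (∀ K L : Set (Matrix.SpecialLinearGroup (Fin n) ℝ ⧸ H),
          IsCompact K → IsCompact L →
          {γ : Γ | ∃ x ∈ K, ((γ : Matrix.SpecialLinearGroup (Fin n) ℝ) • x) ∈ L}.Finite) ∧
        (∃ K : Set (Matrix.SpecialLinearGroup (Fin n) ℝ ⧸ H), IsCompact K ∧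
          ∀ x : Matrix.SpecialLinearGroup (Fin n) ℝ ⧸ H, ∃ γ ∈ Γ, ∃ y ∈ K, γ • y = x)) := by
  rintro ⟨-, hprop, K0, hK0, hcov⟩
  obtain ⟨m, rfl⟩ : ∃ m, n = m + 1 := ⟨n - 1, by omega⟩
  obtain rfl := H_eq_stabilizer m H hH
  have htrans := PX.pretransitive m (by omega)
  let G := Matrix.SpecialLinearGroup (Fin (m + 1)) ℝ
  let φ : G ⧸ MulAction.stabilizer G (PX.base m) → PX (m + 1) :=
    MulAction.ofQuotientStabilizer G (PX.base m)
  have hφmk : ∀ g : G, φ (QuotientGroup.mk g) = g • PX.base m := fun g => rfl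
  have hφinj : Function.Injective φ := MulAction.injective_ofQuotientStabilizer G (PX.base m)
  have hφsmul : ∀ (g : G) x, φ (g • x) = g • φ x :=
    fun g x => MulAction.ofQuotientStabilizer_smul G (PX.base m) g x
  have hφsurj : Function.Surjective φ := by
    intro x
    obtain ⟨g, hg⟩ := MulAction.exists_smul_eq G (PX.base m) x
    exact ⟨QuotientGroup.mk g, hg⟩
  have horb : Continuous fun g : G => g • PX.base m := continuous_id.smul continuous_const
  have hφcont : Continuous φ :=
    isQuotientMap_quotient_mk'.continuous_iff.mpr horb
  have hφopen : IsOpenMap φ := by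
    intro V hV
    have h1 := (isOpenMap_smul_of_sigmaCompact (G := G) (PX.base m)) _
      (hV.preimage QuotientGroup.continuous_mk)
    convert h1 using 1
    ext x; constructor
    · rintro ⟨q, hq, rfl⟩
      obtain ⟨g, rfl⟩ := QuotientGroup.mk_surjective q
      exact ⟨g, hq, rfl⟩
    · rintro ⟨g, hg, rfl⟩
      exact ⟨_, hg, rfl⟩
  let e : G ⧸ MulAction.stabilizer G (PX.base m) ≃ₜ PX (m + 1) :=
    (Equiv.ofBijective φ ⟨hφinj, hφsurj⟩).toHomeomorphOfContinuousOpen hφcont hφopen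
  have he : ∀ q, e q = φ q := fun q => rfl
  refine PX.main (m + 1) (by omega) hodd Γ ?_ ?_
  · intro K L hK hL
    refine (hprop (e ⁻¹' K) (e ⁻¹' L) (e.isCompact_preimage.mpr hK)
      (e.isCompact_preimage.mpr hL)).subset ?_
    rintro γ ⟨x, hx, hγx⟩
    obtain ⟨q, rfl⟩ := e.surjective x
    refine ⟨q, hx, ?_⟩
    rw [Set.mem_preimage, he, hφsmul]; exact hγx
  · refine ⟨e '' K0, hK0.image e.continuous, fun x => ?_⟩
    obtain ⟨q, rfl⟩ := e.surjective x
    obtain ⟨γ, hγ, y, hy, rfl⟩ := hcov q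
    exact ⟨γ, hγ, e y, ⟨y, hy, rfl⟩, (hφsmul γ y).symm⟩
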